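/- arXiv:1612.08152 — 8 statements merged into one kernel-verified Lean document; each statement's English description precedes it below -/
import Mathlib

section
/- Let t ≥ 1 be an integer and let λ : ℤ → ℕ be finitely supported with |λ| = t. Then h(λ) ≥ (t+1)(t+2)/2 = C(t+2,2), and equality holds if and only if λ = t·ε_k for some k ∈ ℤ. -/
open scoped BigOperators

/-- `Pset lam` is the set of functions `ρ : ℤ → ℕ` satisfying
`ρ(i+1) ≤ lam(i+1) + min (lam i) (ρ i)` for all `i`. -/
def Pset (lam : ℤ → ℕ) : Set (ℤ → ℕ) :=
  {ρ | ∀ i : ℤ, ρ (i + 1) ≤ lam (i + 1) + min (lam i) (ρ i)}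

/-- `hfun lam` is the cardinality of `Pset lam`. -/
noncomputable def hfun (lam : ℤ → ℕ) : ℕ := (Pset lam).ncard

/-- The functions satisfying the constraints of `Pset lam` at the positions `s + 1, …, s + n`
and vanishing everywhere else. -/
noncomputable def windowSet (lam : ℤ → ℕ) (s : ℤ) : ℕ → Finset (ℤ → ℕ)
  | 0 => {0}
  | n + 1 => by
    classical
    exact (windowSet lam s n).biUnion fun ρ =>
      (Finset.range (lam (s + n + 1) + min (lam (s + n)) (ρ (s + n)) + 1)).image fun y =>
        Function.update ρ (s + n + 1) y

theorem windowSet_apply_eq_zero (lam : ℤ → ℕ) (s : ℤ) (n : ℕ) {ρ : ℤ → ℕ}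
    (hρ : ρ ∈ windowSet lam s n) {i : ℤ} (hi : i ≤ s ∨ s + n < i) : ρ i = 0 := by
  induction n generalizing ρ with
  | zero => simp_all [windowSet]
  | succ n ih =>
    simp only [windowSet, Finset.mem_biUnion, Finset.mem_image] at hρ
    obtain ⟨σ, hσ, y, -, rfl⟩ := hρ
    push_cast at hi
    rw [Function.update_of_ne (by omega)]
    exact ih hσ (by omega)

theorem mem_windowSet (lam : ℤ → ℕ) (s : ℤ) (n : ℕ) (ρ : ℤ → ℕ) :
    ρ ∈ windowSet lam s n ↔ (∀ i, i ≤ s ∨ s + n < i → ρ i = 0) ∧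
      ∀ i, s ≤ i → i < s + n → ρ (i + 1) ≤ lam (i + 1) + min (lam i) (ρ i) := by
  induction n generalizing ρ with
  | zero =>
    simp only [windowSet, Finset.mem_singleton]
    constructor
    · rintro rfl
      simp
    · rintro ⟨h, -⟩
      funext i
      exact h i (by push_cast; omega)
  | succ n ih =>
    constructor
    · intro hρ
      refine ⟨fun i hi => windowSet_apply_eq_zero lam s _ hρ hi, ?_⟩
      simp only [windowSet, Finset.mem_biUnion, Finset.mem_image, Finset.mem_range] at hρ
      obtain ⟨σ, hσ, y, hy, rfl⟩ := hρ
      intro i h1 h2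
      push_cast at h2
      rw [Function.update_of_ne (a := i) (by omega)]
      rcases eq_or_ne i (s + n) with rfl | hne
      · rw [Function.update_self]
        omega
      · rw [Function.update_of_ne (by omega)]
        exact ((ih σ).1 hσ).2 i h1 (by omega)
    · rintro ⟨h0, h1⟩
      simp only [windowSet, Finset.mem_biUnion, Finset.mem_image, Finset.mem_range]
      push_cast at h0 h1
      refine ⟨Function.update ρ (s + n + 1) 0, (ih _).2 ⟨fun i hi => ?_, fun i h2 h3 => ?_⟩,
        ρ (s + n + 1), ?_, ?_⟩
      · rcases eq_or_ne i (s + n + 1) with rfl | hne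
        · simp
        · rw [Function.update_of_ne hne]
          exact h0 i (by omega)
      · rw [Function.update_of_ne (by omega), Function.update_of_ne (by omega)]
        exact h1 i h2 (by omega)
      · rw [Function.update_of_ne (by omega)]
        have := h1 (s + n) (by omega) (by omega)
        omega
      · simp

theorem sum_windowSet_succ (lam : ℤ → ℕ) (s : ℤ) (n : ℕ) (f : ℕ → ℕ) :
    ∑ ρ ∈ windowSet lam s (n + 1), f (ρ (s + n + 1)) =
      ∑ ρ ∈ windowSet lam s n,
        ∑ y ∈ Finset.range (lam (s + n + 1) + min (lam (s + n)) (ρ (s + n)) + 1), f y := by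
  classical
  rw [windowSet, Finset.sum_biUnion]
  · refine Finset.sum_congr rfl fun ρ _ => ?_
    rw [Finset.sum_image]
    · simp
    · intro y _ z _ h
      simpa using congrFun h (s + n + 1)
  · intro ρ hρ σ hσ hne
    refine Finset.disjoint_left.2 fun τ h1 h2 => hne ?_
    simp only [Finset.mem_image] at h1 h2
    obtain ⟨y, -, rfl⟩ := h1
    obtain ⟨z, -, h⟩ := h2
    funext i
    rcases eq_or_ne i (s + n + 1) with rfl | hi
    · rw [windowSet_apply_eq_zero lam s n hρ (by omega),
        windowSet_apply_eq_zero lam s n hσ (by omega)]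
    · simpa [Function.update_of_ne hi] using (congrFun h i).symm

theorem sum_range_one_add_min (b m : ℕ) :
    ∑ y ∈ Finset.range (b + m + 1), (1 + min b y) = (b + 1) * (1 + m) + (b + 1).choose 2 := by
  induction m with
  | zero =>
    have h : ∑ y ∈ Finset.range (b + 1), (1 + min b y) = ∑ y ∈ Finset.range (b + 1), (1 + y) :=
      Finset.sum_congr rfl fun y hy => by
        have := Finset.mem_range.1 hy
        omega
    simp only [add_zero]
    rw [h, Finset.sum_add_distrib, Finset.sum_range_id, Nat.choose_two_right]
    simp
  | succ m ih =>
    rw [← add_assoc, Finset.sum_range_succ, ih]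
    have : min b (b + m + 1) = b := by omega
    rw [this]
    ring

/-- The number of ways to extend the elements of `windowSet lam s n` by one position at which
`lam` vanishes. -/
noncomputable def windowWeight (lam : ℤ → ℕ) (s : ℤ) (n : ℕ) : ℕ :=
  ∑ ρ ∈ windowSet lam s n, (1 + min (lam (s + n)) (ρ (s + n)))

theorem card_windowSet_succ (lam : ℤ → ℕ) (s : ℤ) (n : ℕ) :
    (windowSet lam s (n + 1)).card =
      lam (s + n + 1) * (windowSet lam s n).card + windowWeight lam s n := by
  have h := sum_windowSet_succ lam s n fun _ => 1
  simp only [Finset.sum_const, smul_eq_mul, mul_one, Finset.card_range] at h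
  rw [h, windowWeight, mul_comm, ← smul_eq_mul, ← Finset.sum_const, ← Finset.sum_add_distrib]
  exact Finset.sum_congr rfl fun _ _ => by omega

theorem windowWeight_succ (lam : ℤ → ℕ) (s : ℤ) (n : ℕ) :
    windowWeight lam s (n + 1) = (lam (s + n + 1) + 1) * windowWeight lam s n +
      (lam (s + n + 1) + 1).choose 2 * (windowSet lam s n).card := by
  have h := sum_windowSet_succ lam s n fun y => 1 + min (lam (s + n + 1)) y
  simp only [sum_range_one_add_min] at h
  rw [windowWeight]
  push_cast
  rw [← add_assoc, h, Finset.sum_add_distrib, ← Finset.mul_sum, Finset.sum_const, smul_eq_mul,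
    windowWeight, mul_comm (Finset.card _)]

theorem coe_windowSet_eq_Pset (lam : ℤ → ℕ) (s : ℤ) (n : ℕ) (hs : ∀ i ≤ s, lam i = 0)
    (hn : ∀ i, s + n ≤ i → lam i = 0) : (windowSet lam s n : Set (ℤ → ℕ)) = Pset lam := by
  ext ρ
  rw [Finset.mem_coe, mem_windowSet]
  constructor
  · rintro ⟨h0, h1⟩ i
    by_cases hi : s ≤ i ∧ i < s + n
    · exact h1 i hi.1 hi.2
    · rw [h0 (i + 1) (by omega)]
      exact Nat.zero_le _
  · intro h
    refine ⟨fun i hi => ?_, fun i _ _ => h i⟩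
    have h1 := h (i - 1)
    rw [sub_add_cancel] at h1
    rcases hi with hi | hi
    · have := hs i hi
      have := hs (i - 1) (by omega)
      omega
    · have := hn i (by omega)
      have := hn (i - 1) (by omega)
      omega

theorem choose_two_add (m n : ℕ) : (m + n).choose 2 = m.choose 2 + m * n + n.choose 2 := by
  induction n with
  | zero => simp
  | succ n ih =>
    rw [← add_assoc, Nat.choose_succ_succ' (m + n) 1, Nat.choose_succ_succ' n 1, ih]
    simp
    ring

/-- Two sequences following the recursion of `windowSet` cardinalities and weights. -/
theorem choose_two_le_of_recursion (b N W : ℕ → ℕ) (hN0 : N 0 = 1) (hW0 : W 0 = 1)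
    (hN : ∀ n, N (n + 1) = b n * N n + W n)
    (hW : ∀ n, W (n + 1) = (b n + 1) * W n + (b n + 1).choose 2 * N n) (n : ℕ) :
    ∑ j ∈ Finset.range n, b j + 1 ≤ N n ∧
      (∑ j ∈ Finset.range n, b j + 2).choose 2 ≤ W n ∧
      (W n = (∑ j ∈ Finset.range n, b j + 2).choose 2 ↔
        ∃ k, ∀ j < n, j ≠ k → b j = 0) ∧
      (∑ j ∈ Finset.range n, b j = 0 → N n = 1 ∧ W n = 1) := by
  induction n with
  | zero => simp [hN0, hW0]
  | succ n ih =>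
    have hex : (∃ k, ∀ j < n + 1, j ≠ k → b j = 0) ↔
        (∃ k, ∀ j < n, j ≠ k → b j = 0) ∧ (∑ j ∈ Finset.range n, b j = 0 ∨ b n = 0) := by
      constructor
      · rintro ⟨k, hk⟩
        refine ⟨⟨k, fun j hj => hk j (by omega)⟩, ?_⟩
        rcases eq_or_ne n k with rfl | hne
        · exact .inl (Finset.sum_eq_zero fun j hj => by
            have := Finset.mem_range.1 hj
            exact hk j (by omega) (by omega))
        · exact .inr (hk n (by omega) hne)
      · rintro ⟨⟨k, hk⟩, h | h⟩
        · refine ⟨n, fun j hj hne => ?_⟩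
          exact (Finset.sum_eq_zero_iff.1 h) j (Finset.mem_range.2 (by omega))
        · refine ⟨k, fun j hj hne => ?_⟩
          rcases eq_or_ne j n with rfl | hjn
          · exact h
          · exact hk j (by omega) hne
    rw [Finset.sum_range_succ, hex, hN, hW]
    obtain ⟨h1, h2, h3, h4⟩ := ih
    rw [← h3]
    generalize ∑ j ∈ Finset.range n, b j = T at *
    have e1 : (T + b n + 2).choose 2 =
        (T + 1).choose 2 + (T + 1) * (b n + 1) + (b n + 1).choose 2 := by
      rw [← choose_two_add]
      congr 1
      ring
    have e2 : (T + 2).choose 2 = (T + 1).choose 2 + (T + 1) := by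
      rw [Nat.choose_succ_succ' (T + 1) 1]
      simp
      ring
    have pT : T ≤ (T + 1).choose 2 := by
      rw [Nat.choose_succ_succ' T 1]
      simp
    have pb : b n ≤ (b n + 1).choose 2 := by
      rw [Nat.choose_succ_succ' (b n) 1]
      simp
    rw [e1]
    rw [e2] at h2 h3 ⊢
    generalize b n = B at *
    obtain ⟨x, hx⟩ := Nat.exists_eq_add_of_le h1
    obtain ⟨w, hw⟩ := Nat.exists_eq_add_of_le h2
    rw [hx, hw] at h4 ⊢
    rw [hw] at h3
    have key : (B + 1) * ((T + 1).choose 2 + (T + 1) + w) + (B + 1).choose 2 * (T + 1 + x) =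
        (T + 1).choose 2 + (T + 1) * (B + 1) + (B + 1).choose 2 +
        (B * (T + 1).choose 2 + (B + 1) * w + (B + 1).choose 2 * (T + x)) := by ring
    rw [key]
    refine ⟨by nlinarith, by omega, ?_, ?_⟩
    · constructor
      · intro h
        have h5 : B * (T + 1).choose 2 + (B + 1) * w + (B + 1).choose 2 * (T + x) = 0 := by omega
        simp only [Nat.add_eq_zero_iff, mul_eq_zero] at h5
        omega
      · rintro ⟨h5, h6⟩
        have hw0 : w = 0 := by omega
        subst hw0
        rcases h6 with rfl | rfl
        · have hx0 : x = 0 := by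
            have := (h4 rfl).1
            omega
          subst hx0
          simp
        · simp
    · intro h
      obtain ⟨rfl, rfl⟩ : T = 0 ∧ B = 0 := by omega
      have := h4 rfl
      simp_all

theorem stmt0 (t : ℕ) (ht : 1 ≤ t) (lam : ℤ → ℕ)
    (hfin : (Function.support lam).Finite) (hsum : ∑ᶠ i, lam i = t) :
    (t + 1) * (t + 2) / 2 = (t + 2).choose 2 ∧
    (t + 2).choose 2 ≤ hfun lam ∧
    (hfun lam = (t + 2).choose 2 ↔
      ∃ k : ℤ, lam = fun i => if i = k then t else 0) := by
  obtain ⟨a, ha⟩ := hfin.bddBelow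
  obtain ⟨c, hc⟩ := hfin.bddAbove
  have hlow : ∀ i ≤ a - 1, lam i = 0 := fun i hi => by
    by_contra h
    have := ha (Function.mem_support.2 h)
    omega
  obtain ⟨n, hn⟩ : ∃ n : ℕ, c + 1 ≤ a - 1 + n + 1 := ⟨(c + 1 - a).toNat, by omega⟩
  have hhigh : ∀ i, a - 1 + n + 1 ≤ i → lam i = 0 := fun i hi => by
    by_contra h
    have := hc (Function.mem_support.2 h)
    omega
  generalize a - 1 = s at *
  have hcard : hfun lam = windowWeight lam s n := by
    rw [hfun, ← coe_windowSet_eq_Pset lam s (n + 1) hlow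
      (fun i hi => hhigh i (by push_cast at hi; omega)), Set.ncard_coe_finset,
      card_windowSet_succ, hhigh _ le_rfl]
    simp
  have hT : ∑ j ∈ Finset.range n, lam (s + j + 1) = t := by
    rw [← hsum, finsum_eq_sum_of_support_subset (s := (Finset.range n).image
      fun j : ℕ => s + j + 1), Finset.sum_image]
    · intro x _ y _ h
      simpa using h
    · intro i hi
      simp only [Finset.coe_image, Set.mem_image, Finset.mem_coe, Finset.mem_range]
      have h1 : s < i := by
        by_contra h
        exact hi (hlow i (by omega))
      have h2 : i < s + n + 1 := by
        by_contra h
        exact hi (hhigh i (by omega))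
      exact ⟨(i - s - 1).toNat, by omega, by omega⟩
  obtain ⟨-, h2, h3, -⟩ := choose_two_le_of_recursion (fun j => lam (s + j + 1))
    (fun n => (windowSet lam s n).card) (windowWeight lam s) (by simp [windowSet])
    (by simp [windowSet, windowWeight]) (card_windowSet_succ lam s) (windowWeight_succ lam s) n
  simp only [hT] at h2 h3
  refine ⟨by rw [Nat.choose_two_right, mul_comm]; rfl, hcard ▸ h2, ?_⟩
  rw [hcard, h3]
  constructor
  · rintro ⟨k, hk⟩
    have hz : ∀ i, i ≠ s + k + 1 → lam i = 0 := fun i hi => by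
      by_cases h1 : s < i ∧ i < s + n + 1
      · have := hk (i - s - 1).toNat (by omega) (by omega)
        rwa [show s + ((i - s - 1).toNat : ℤ) + 1 = i by omega] at this
      · by_cases h2 : i ≤ s
        · exact hlow i h2
        · exact hhigh i (by omega)
    refine ⟨s + k + 1, funext fun i => ?_⟩
    split_ifs with hi
    · rw [hi, ← hsum, finsum_eq_single lam _ hz]
    · exact hz i hi
  · rintro ⟨k, hk⟩
    refine ⟨(k - s - 1).toNat, fun j _ hne => ?_⟩
    rw [hk]
    exact if_neg (by omega)
end

section
/- Let λ : ℤ → ℕ be finitely supported and let j ∈ ℤ satisfy λ(j) = 0. Define λ^{≤j}, λ^{≥j} : ℤ → ℕ by λ^{≤j}(i) = λ(i) for i ≤ j and λ^{≤j}(i) = 0 for i > j, and λ^{≥j}(i) = λ(i) for i ≥ j and λ^{≥j}(i) = 0 for i < j. Then h(λ) = h(λ^{≤j}) · h(λ^{≥j}). -/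
open scoped BigOperators

/-- An element of `Pset lam` vanishes wherever `lam` vanishes at a point and its predecessor. -/
theorem Pset.eq_zero {lam ρ : ℤ → ℕ} (hρ : ρ ∈ Pset lam) {i : ℤ} (h : lam i = 0)
    (h' : lam (i - 1) = 0) : ρ i = 0 := by
  have := hρ (i - 1)
  rw [sub_add_cancel, h, h'] at this
  omega

/-- If `lam j = 0`, the elements of `Pset lam` are the sums of an element for the part of `lam`
up to `j` and an element for the part of `lam` from `j` on. -/
theorem Pset_eq_image_add (lam : ℤ → ℕ) (j : ℤ) (hj : lam j = 0) :
    Pset lam = (fun p : (ℤ → ℕ) × (ℤ → ℕ) => p.1 + p.2) ''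
      (Pset (fun i => if i ≤ j then lam i else 0) ×ˢ
        Pset (fun i => if j ≤ i then lam i else 0)) := by
  ext ρ
  constructor
  · intro hρ
    refine ⟨(fun i => if i ≤ j then ρ i else 0, fun i => if j < i then ρ i else 0),
      ⟨fun i => ?_, fun i => ?_⟩, ?_⟩
    · have := hρ i
      dsimp only
      split_ifs <;> omega
    · have := hρ i
      dsimp only
      rcases lt_trichotomy i j with h | rfl | h
      · simp [show ¬ j < i + 1 by omega]
      · simpa [hj] using this
      · simpa [h, h.le, show j < i + 1 by omega, show j ≤ i + 1 by omega] using this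
    · funext i
      dsimp only [Pi.add_apply]
      split_ifs <;> omega
  · rintro ⟨⟨a, b⟩, ⟨ha, hb⟩, rfl⟩ i
    have hai := ha i
    have hbi := hb i
    dsimp only [Pi.add_apply] at hai hbi ⊢
    rcases lt_trichotomy i j with h | rfl | h
    · simp only [show i ≤ j by omega, show i + 1 ≤ j by omega, if_true] at hai
      simp only [show ¬ j ≤ i by omega, if_false] at hbi
      have : (if j ≤ i + 1 then lam (i + 1) else 0) = 0 := by
        split_ifs with h1
        · rwa [show i + 1 = j by omega]
        · rfl
      omega
    · simp [hj] at hai hbi ⊢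
      omega
    · simp only [show ¬ i ≤ j by omega, show ¬ i + 1 ≤ j by omega, if_false] at hai
      simp only [show j ≤ i by omega, show j ≤ i + 1 by omega, if_true] at hbi
      omega

/-- The decomposition of an element of `Pset lam` at a zero of `lam` is unique. -/
theorem Pset_injOn_add (lam : ℤ → ℕ) (j : ℤ) (hj : lam j = 0) :
    Set.InjOn (fun p : (ℤ → ℕ) × (ℤ → ℕ) => p.1 + p.2)
      (Pset (fun i => if i ≤ j then lam i else 0) ×ˢ
        Pset (fun i => if j ≤ i then lam i else 0)) := by
  have left {a : ℤ → ℕ} (ha : a ∈ Pset (fun i => if i ≤ j then lam i else 0)) {i : ℤ}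
      (hi : j < i) : a i = 0 := by
    refine Pset.eq_zero ha (by simp [hi]) ?_
    rcases eq_or_ne (i - 1) j with h | h
    · simp [h, hj]
    · simp only [show ¬ i - 1 ≤ j by omega, if_false]
  have right {b : ℤ → ℕ} (hb : b ∈ Pset (fun i => if j ≤ i then lam i else 0)) {i : ℤ}
      (hi : i ≤ j) : b i = 0 := by
    refine Pset.eq_zero hb ?_ (by simp only [show ¬ j ≤ i - 1 by omega, if_false])
    rcases eq_or_ne i j with rfl | h
    · simp [hj]
    · simp only [show ¬ j ≤ i by omega, if_false]
  rintro ⟨a, b⟩ ⟨ha, hb⟩ ⟨c, d⟩ ⟨hc, hd⟩ h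
  have key (i : ℤ) : a i = c i ∧ b i = d i := by
    have hi : a i + b i = c i + d i := congrFun h i
    rcases le_or_gt i j with hij | hij
    · have : b i = 0 := right hb hij
      have : d i = 0 := right hd hij
      omega
    · have : a i = 0 := left ha hij
      have : c i = 0 := left hc hij
      omega
  exact Prod.ext (funext fun i => (key i).1) (funext fun i => (key i).2)

theorem stmt2 (lam : ℤ → ℕ) (hfin : (Function.support lam).Finite)
    (j : ℤ) (hj : lam j = 0) :
    hfun lam =
      hfun (fun i => if i ≤ j then lam i else 0) *
      hfun (fun i => if j ≤ i then lam i else 0) := by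
  unfold hfun
  rw [Pset_eq_image_add lam j hj, (Pset_injOn_add lam j hj).ncard_image,
    Set.ncard_prod]
end

section
/- For every k ∈ ℤ and every t ∈ ℕ, h(t·ε_k) = (t+1)(t+2)/2 = C(t+2,2); explicitly, the elements of P(t·ε_k) are exactly the functions ρ supported in {k, k+1} with 0 ≤ ρ(k+1) ≤ ρ(k) ≤ t. -/
open scoped BigOperators

theorem Pset_single (k : ℤ) (t : ℕ) :
    Pset (fun i => if i = k then t else 0) =
      {ρ : ℤ → ℕ | (∀ i : ℤ, i ≠ k → i ≠ k + 1 → ρ i = 0) ∧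
        ρ (k + 1) ≤ ρ k ∧ ρ k ≤ t} := by
  ext ρ
  simp only [Pset, Set.mem_ofPred_eq]
  constructor
  · intro h
    refine ⟨fun i hik hik1 => ?_, ?_, ?_⟩
    · have := h (i - 1)
      rw [sub_add_cancel, if_neg hik, if_neg (by omega)] at this
      omega
    · have := h k
      rw [if_neg (by omega), if_pos rfl] at this
      omega
    · have := h (k - 1)
      rw [sub_add_cancel, if_pos rfl, if_neg (by omega)] at this
      omega
  · rintro ⟨h0, h1, h2⟩ i
    by_cases hi : i = k
    · subst hi
      rw [if_neg (by omega), if_pos rfl]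
      omega
    by_cases hi1 : i + 1 = k
    · rw [if_pos hi1, hi1]
      omega
    · rw [h0 (i + 1) hi1 (by omega)]
      exact Nat.zero_le _

/-- The function `ℤ → ℕ` with value `a` at `k`, `b` at `k + 1`, and `0` elsewhere. -/
def consecutivePair (k : ℤ) (p : Σ _ : ℕ, ℕ) : ℤ → ℕ :=
  fun i => if i = k then p.1 else if i = k + 1 then p.2 else 0

@[simp]
theorem consecutivePair_left (k : ℤ) (p : Σ _ : ℕ, ℕ) : consecutivePair k p k = p.1 := by
  simp [consecutivePair]

@[simp]
theorem consecutivePair_right (k : ℤ) (p : Σ _ : ℕ, ℕ) : consecutivePair k p (k + 1) = p.2 := by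
  simp [consecutivePair]

theorem consecutivePair_injective (k : ℤ) : Function.Injective (consecutivePair k) := by
  rintro ⟨a, b⟩ ⟨c, d⟩ h
  have hk := congrFun h k
  have hk1 := congrFun h (k + 1)
  simp only [consecutivePair_left, consecutivePair_right] at hk hk1
  rw [hk, hk1]

theorem image_consecutivePair (k : ℤ) (t : ℕ) :
    consecutivePair k '' ((Finset.range (t + 1)).sigma fun a => Finset.range (a + 1)) =
      {ρ : ℤ → ℕ | (∀ i : ℤ, i ≠ k → i ≠ k + 1 → ρ i = 0) ∧
        ρ (k + 1) ≤ ρ k ∧ ρ k ≤ t} := by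
  ext ρ
  simp only [Set.mem_image, Finset.mem_coe, Finset.mem_sigma, Finset.mem_range,
    Order.lt_add_one_iff, Set.mem_ofPred_eq]
  constructor
  · rintro ⟨p, ⟨h1, h2⟩, rfl⟩
    simp only [consecutivePair_left, consecutivePair_right]
    exact ⟨fun i hi hi1 => by simp [consecutivePair, hi, hi1], h2, h1⟩
  · rintro ⟨h0, h1, h2⟩
    refine ⟨⟨ρ k, ρ (k + 1)⟩, ⟨h2, h1⟩, funext fun i => ?_⟩
    unfold consecutivePair
    split_ifs with hi hi1
    · rw [hi]
    · rw [hi1]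
    · exact (h0 i hi hi1).symm

theorem sum_range_add_one (t : ℕ) :
    ∑ a ∈ Finset.range (t + 1), (a + 1) = (t + 2).choose 2 := by
  induction t with
  | zero => rfl
  | succ t ih =>
    rw [Finset.sum_range_succ, ih, Nat.choose_succ_succ' (t + 2) 1, Nat.choose_one_right]
    ring

theorem stmt3 (k : ℤ) (t : ℕ) :
    hfun (fun i => if i = k then t else 0) = (t + 2).choose 2 ∧
    (t + 1) * (t + 2) / 2 = (t + 2).choose 2 ∧
    Pset (fun i => if i = k then t else 0) =
      {ρ : ℤ → ℕ | (∀ i : ℤ, i ≠ k → i ≠ k + 1 → ρ i = 0) ∧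
        ρ (k + 1) ≤ ρ k ∧ ρ k ≤ t} := by
  refine ⟨?_, ?_, Pset_single k t⟩
  · rw [hfun, Pset_single, ← image_consecutivePair,
      Set.ncard_image_of_injective _ (consecutivePair_injective k), Set.ncard_coe_finset,
      Finset.card_sigma]
    simp only [Finset.card_range]
    exact sum_range_add_one t
  · rw [Nat.choose_two_right, Nat.add_sub_assoc (by norm_num), mul_comm]
end

section
/- Let λ : ℤ → ℕ be finitely supported and let k ∈ ℤ be such that λ(k) > 0, λ(k+1) > 0, and λ(j) = 0 for all j > k+1. Define λ′ : ℤ → ℕ by λ′(k) = λ(k) + λ(k+1), λ′(k+1) = 0, and λ′(j) = λ(j) for all j ∉ {k, k+1}. Then h(λ) > h(λ′). -/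
open scoped BigOperators

theorem Pset_finite {lam : ℤ → ℕ} (hfin : (Function.support lam).Finite) :
    (Pset lam).Finite := by
  have hg : (Function.support fun i => lam i + lam (i - 1)).Finite := by
    refine (hfin.union (hfin.preimage (sub_left_injective (b := (1 : ℤ))).injOn)).subset ?_
    intro i hi
    simp only [Function.mem_support, Set.mem_union, Set.mem_preimage] at hi ⊢
    omega
  have hle : ∀ ρ ∈ Pset lam, ∀ i, ρ i ≤ lam i + lam (i - 1) := by
    intro ρ hρ i
    have h := hρ (i - 1)
    rw [sub_add_cancel] at h
    omega
  refine ((Set.finite_Iic (Finsupp.ofSupportFinite _ hg)).image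
    (fun f : ℤ →₀ ℕ => (f : ℤ → ℕ))).subset ?_
  intro ρ hρ
  have hs : (Function.support ρ).Finite := by
    refine hg.subset ?_
    intro i hi
    have h := hle ρ hρ i
    simp only [Function.mem_support] at hi ⊢
    omega
  exact ⟨Finsupp.ofSupportFinite ρ hs, fun i => hle ρ hρ i, rfl⟩

/-- Splits a pair `(x, y)` into a triple whose first entry is at most `B`, injectively on the pairs
with `y ≤ x`; the excess of `x` over `B` moves to the other two entries. -/
def splitTail (B x y : ℕ) : ℕ × ℕ × ℕ :=
  if x ≤ B then (x, y, 0) else if x - B ≤ y then (B, y, x - B) else (0, x - B, y + 1)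

theorem splitTail_inj {B x y x' y' : ℕ} (hB : 0 < B)
    (h : splitTail B x y = splitTail B x' y') : x = x' ∧ y = y' := by
  unfold splitTail at h
  split_ifs at h <;> simp only [Prod.mk.injEq] at h <;> omega

theorem splitTail_bounds {b c m x y : ℕ} (hx : x ≤ b + c + m) (hy : y ≤ min (b + c) x) :
    (splitTail (b + m) x y).1 ≤ b + m ∧
    (splitTail (b + m) x y).2.1 ≤ c + min b (splitTail (b + m) x y).1 ∧
    (splitTail (b + m) x y).2.2 ≤ min c (splitTail (b + m) x y).2.1 := by
  unfold splitTail
  split_ifs <;> dsimp only <;> omega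

theorem splitTail_ne {B x y : ℕ} (hy : y ≤ x) : splitTail B x y ≠ (0, 1, 0) := by
  unfold splitTail
  split_ifs <;> simp only [ne_eq, Prod.mk.injEq] <;> omega

/-- Keeps `ρ` to the left of `k` and replaces the rest by the triple `t`, followed by zeros. -/
def replaceTail (k : ℤ) (ρ : ℤ → ℕ) (t : ℕ × ℕ × ℕ) (j : ℤ) : ℕ :=
  if j < k then ρ j else if j = k then t.1 else if j = k + 1 then t.2.1
    else if j = k + 2 then t.2.2 else 0

theorem replaceTail_inj {k : ℤ} {ρ σ : ℤ → ℕ} {t u : ℕ × ℕ × ℕ}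
    (h : replaceTail k ρ t = replaceTail k σ u) : (∀ j < k, ρ j = σ j) ∧ t = u := by
  refine ⟨fun j hj => by simpa [replaceTail, hj] using congrFun h j, ?_⟩
  have e0 := congrFun h k
  have e1 := congrFun h (k + 1)
  have e2 := congrFun h (k + 2)
  simp [replaceTail] at e0 e1 e2
  exact Prod.ext e0 (Prod.ext e1 e2)

theorem replaceTail_mem_Pset {lam ρ : ℤ → ℕ} {k : ℤ} {t : ℕ × ℕ × ℕ}
    (hρ : ∀ i, i + 1 < k → ρ (i + 1) ≤ lam (i + 1) + min (lam i) (ρ i))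
    (h0 : t.1 ≤ lam k + min (lam (k - 1)) (ρ (k - 1)))
    (h1 : t.2.1 ≤ lam (k + 1) + min (lam k) t.1)
    (h2 : t.2.2 ≤ min (lam (k + 1)) t.2.1) :
    replaceTail k ρ t ∈ Pset lam := by
  intro i
  rcases lt_or_ge (i + 1) k with hi | hi
  · have hi' : i < k := by omega
    simpa [replaceTail, hi, hi'] using hρ i hi
  · rcases (show i = k - 1 ∨ i = k ∨ i = k + 1 ∨ k + 1 < i by omega) with rfl | rfl | rfl | hi'
    · simpa [replaceTail] using h0
    · simpa [replaceTail] using h1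
    · have e : k + 1 + 1 = k + 2 := by ring
      rw [e]
      simp [replaceTail]
      omega
    · have : replaceTail k ρ t (i + 1) = 0 := by
        unfold replaceTail
        split_ifs <;> omega
      omega

theorem stmt4 (lam : ℤ → ℕ) (hfin : (Function.support lam).Finite)
    (k : ℤ) (h1 : 0 < lam k) (h2 : 0 < lam (k + 1))
    (h3 : ∀ j : ℤ, k + 1 < j → lam j = 0) :
    hfun (fun j => if j = k then lam k + lam (k + 1)
      else if j = k + 1 then 0 else lam j) < hfun lam := by
  set lam' : ℤ → ℕ := fun j => if j = k then lam k + lam (k + 1)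
      else if j = k + 1 then 0 else lam j with hlam'
  have v0 : lam' k = lam k + lam (k + 1) := by simp [hlam']
  have v1 : lam' (k + 1) = 0 := by simp [hlam']
  have vlt : ∀ j < k, lam' j = lam j := fun j hj => by
    simp [hlam', hj.ne, show j ≠ k + 1 by omega]
  have vgt : ∀ j, k < j → lam' j = 0 := fun j hj => by
    simp only [hlam']
    split_ifs
    · omega
    · rfl
    · exact h3 j (by omega)
  let F : (ℤ → ℕ) → ℤ → ℕ := fun ρ => replaceTail k ρ
    (splitTail (lam k + min (lam (k - 1)) (ρ (k - 1))) (ρ k) (ρ (k + 1)))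
  have hx : ∀ ρ ∈ Pset lam', ρ k ≤ lam k + lam (k + 1) + min (lam (k - 1)) (ρ (k - 1)) := by
    intro ρ hρ
    have h := hρ (k - 1)
    rwa [sub_add_cancel, v0, vlt _ (by omega)] at h
  have hy : ∀ ρ ∈ Pset lam', ρ (k + 1) ≤ min (lam k + lam (k + 1)) (ρ k) := by
    intro ρ hρ
    have h := hρ k
    rwa [v0, v1, zero_add] at h
  have hz : ∀ ρ ∈ Pset lam', ∀ j, k + 1 < j → ρ j = 0 := by
    intro ρ hρ j hj
    have h := hρ (j - 1)
    rw [sub_add_cancel, vgt j (by omega), vgt (j - 1) (by omega)] at h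
    omega
  have hmaps : ∀ ρ ∈ Pset lam', F ρ ∈ Pset lam := by
    intro ρ hρ
    obtain ⟨b0, b1, b2⟩ := splitTail_bounds (hx ρ hρ) (hy ρ hρ)
    refine replaceTail_mem_Pset (fun i hi => ?_) b0 b1 b2
    have h := hρ i
    rwa [vlt _ hi, vlt i (by omega)] at h
  have hinj : Set.InjOn F (Pset lam') := by
    intro ρ hρ σ hσ h
    obtain ⟨hlt, ht⟩ := replaceTail_inj h
    rw [hlt (k - 1) (by omega)] at ht
    obtain ⟨e0, e1⟩ := splitTail_inj (by omega) ht
    funext j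
    rcases (show j < k ∨ j = k ∨ j = k + 1 ∨ k + 1 < j by omega) with hj | rfl | rfl | hj
    · exact hlt j hj
    · exact e0
    · exact e1
    · rw [hz ρ hρ j hj, hz σ hσ j hj]
  have hmem : replaceTail k 0 (0, 1, 0) ∈ Pset lam :=
    replaceTail_mem_Pset (fun _ _ => Nat.zero_le _) (Nat.zero_le _)
      (by dsimp only; omega) (Nat.zero_le _)
  have hnot : replaceTail k 0 (0, 1, 0) ∉ F '' Pset lam' := by
    rintro ⟨ρ, hρ, h⟩
    exact splitTail_ne ((hy ρ hρ).trans (min_le_right _ _)) (replaceTail_inj h).2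
  unfold hfun
  rw [← hinj.ncard_image]
  refine Set.ncard_lt_ncard ⟨?_, fun h => hnot (h hmem)⟩ (Pset_finite hfin)
  rintro _ ⟨ρ, hρ, rfl⟩
  exact hmaps ρ hρ
end

section
/- Let t ≥ 1 be an integer and let i, j ∈ ℤ. Set λ := t·ε_i and κ := t·ε_j. Then the following are equivalent: (a) |i − j| ≤ 1; (b) there exists ρ ∈ P(λ) such that, for every k ∈ ℤ, κ(k) − λ(k) = (λ(k+1) − ρ(k+1)) − (λ(k) − ρ(k)) as integers. -/
open scoped BigOperators

theorem stmt5 (t : ℕ) (ht : 1 ≤ t) (i j : ℤ) :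
    |i - j| ≤ 1 ↔
      ∃ ρ ∈ Pset (fun a => if a = i then t else 0),
        ∀ k : ℤ,
          ((if k = j then (t : ℤ) else 0) - (if k = i then (t : ℤ) else 0)) =
            (((if k + 1 = i then (t : ℤ) else 0) - (ρ (k + 1) : ℤ)) -
              ((if k = i then (t : ℤ) else 0) - (ρ k : ℤ))) := by
  constructor
  · intro h
    rw [abs_le] at h
    refine ⟨fun k => if (k = i ∧ i ≤ j) ∨ (k = i + 1 ∧ j = i + 1) then t else 0, ?_, ?_⟩
    · intro k
      dsimp only
      split_ifs <;> omega
    · intro k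
      dsimp only
      split_ifs <;> omega
  · rintro ⟨ρ, hρ, h⟩
    by_contra hij
    -- If `j` is outside `{i - 1, i, i + 1}`, both `ρ j` and `ρ (j + 1)` vanish.
    have hfar : j < i - 1 ∨ i + 1 < j := by
      rw [abs_le] at hij
      omega
    have h₁ := hρ (j - 1)
    have h₂ := hρ j
    have h₃ := h j
    simp only [sub_add_cancel] at h₁
    dsimp only at h₂
    split_ifs at h₁ h₂ h₃ <;> omega
end

section
/- Let t ≥ 1 be an integer and for natural numbers a, b set d(a,b;t) := Σ_{r=0}^{t} C(t,r) · t! · a! · b! / ((a+t−r)! · (b+r)!) ∈ ℚ. Then: (i) for all a, b ∈ ℕ one has d(a+1, b; t) < d(a, b; t); and (ii) for all a, b ∈ ℕ one has d(a,b;t) ≤ C(2t,t), with equality if and only if a = b = 0. -/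
open scoped BigOperators

/-- `dfun t a b = Σ_{r=0}^{t} C(t,r) · t! · a! · b! / ((a+t−r)! · (b+r)!)` as a rational number. -/
noncomputable def dfun (t a b : ℕ) : ℚ :=
  ∑ r ∈ Finset.range (t + 1),
    (t.choose r : ℚ) * (t.factorial : ℚ) * (a.factorial : ℚ) * (b.factorial : ℚ) /
      (((a + (t - r)).factorial : ℚ) * ((b + r).factorial : ℚ))

theorem dfun_comm (t a b : ℕ) : dfun t a b = dfun t b a := by
  unfold dfun
  rw [← Finset.sum_range_reflect]
  refine Finset.sum_congr rfl fun r hr => ?_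
  have hr' : r ≤ t := Nat.lt_succ_iff.mp (Finset.mem_range.mp hr)
  rw [Nat.add_sub_cancel, Nat.sub_sub_self hr', Nat.choose_symm hr']
  ring

theorem dfun_zero_zero (t : ℕ) : dfun t 0 0 = ((2 * t).choose t : ℚ) := by
  rw [← Nat.sum_range_choose_sq, dfun, Nat.cast_sum]
  refine Finset.sum_congr rfl fun r hr => ?_
  have hr' : r ≤ t := Nat.lt_succ_iff.mp (Finset.mem_range.mp hr)
  rw [Nat.cast_pow, sq, Nat.cast_choose ℚ hr']
  simp only [zero_add, Nat.factorial_zero, Nat.cast_one, mul_one]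
  rw [mul_comm ((t - r).factorial : ℚ)]
  ring

theorem factorial_div_factorial_add_succ (a s : ℕ) :
    ((a + 1).factorial : ℚ) / ((a + 1 + s).factorial : ℚ) =
      (a + 1) / (a + 1 + s) * ((a.factorial : ℚ) / ((a + s).factorial : ℚ)) := by
  rw [Nat.add_right_comm a 1 s, Nat.factorial_succ, Nat.factorial_succ]
  have h : ((a + s).factorial : ℚ) ≠ 0 := by positivity
  have h' : (a : ℚ) + 1 + s ≠ 0 := by positivity
  have h'' : (a : ℚ) + s + 1 ≠ 0 := by positivity
  push_cast
  field_simp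
  ring

theorem factorial_div_factorial_add_succ_le (a s : ℕ) :
    ((a + 1).factorial : ℚ) / ((a + 1 + s).factorial : ℚ) ≤
      (a.factorial : ℚ) / ((a + s).factorial : ℚ) := by
  rw [factorial_div_factorial_add_succ]
  refine mul_le_of_le_one_left (by positivity) ?_
  rw [div_le_one (by positivity)]
  exact le_add_of_nonneg_right (Nat.cast_nonneg s)

theorem factorial_div_factorial_add_succ_lt (a : ℕ) {s : ℕ} (hs : 0 < s) :
    ((a + 1).factorial : ℚ) / ((a + 1 + s).factorial : ℚ) <
      (a.factorial : ℚ) / ((a + s).factorial : ℚ) := by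
  rw [factorial_div_factorial_add_succ]
  refine mul_lt_of_lt_one_left (by positivity) ?_
  rw [div_lt_one (by positivity)]
  exact lt_add_of_pos_right _ (Nat.cast_pos.mpr hs)

theorem dfun_eq_sum_mul (t a b : ℕ) :
    dfun t a b = ∑ r ∈ Finset.range (t + 1),
      (t.choose r : ℚ) * t.factorial * b.factorial / (b + r).factorial *
        ((a.factorial : ℚ) / ((a + (t - r)).factorial : ℚ)) := by
  refine Finset.sum_congr rfl fun r _ => ?_
  rw [div_mul_div_comm]
  congr 1 <;> ring

theorem dfun_succ_lt {t : ℕ} (ht : 1 ≤ t) (a b : ℕ) : dfun t (a + 1) b < dfun t a b := by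
  rw [dfun_eq_sum_mul, dfun_eq_sum_mul]
  refine Finset.sum_lt_sum (fun r _ => ?_) ⟨0, by simp, ?_⟩
  · exact mul_le_mul_of_nonneg_left (factorial_div_factorial_add_succ_le a (t - r))
      (by positivity)
  · refine mul_lt_mul_of_pos_left (factorial_div_factorial_add_succ_lt a (by omega)) ?_
    rw [Nat.choose_zero_right]
    positivity

theorem dfun_strictAnti {t : ℕ} (ht : 1 ≤ t) (b : ℕ) : StrictAnti fun a => dfun t a b :=
  strictAnti_nat_of_succ_lt fun a => dfun_succ_lt ht a b

theorem stmt6 (t : ℕ) (ht : 1 ≤ t) :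
    (∀ a b : ℕ, dfun t (a + 1) b < dfun t a b) ∧
    (∀ a b : ℕ, dfun t a b ≤ ((2 * t).choose t : ℚ) ∧
      (dfun t a b = ((2 * t).choose t : ℚ) ↔ a = 0 ∧ b = 0)) := by
  refine ⟨dfun_succ_lt ht, fun a b => ?_⟩
  have ha : dfun t a b ≤ dfun t 0 b := (dfun_strictAnti ht b).antitone (Nat.zero_le a)
  have hb : dfun t 0 b ≤ dfun t 0 0 := by
    rw [dfun_comm t 0 b]
    exact (dfun_strictAnti ht 0).antitone (Nat.zero_le b)
  rw [← dfun_zero_zero]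
  refine ⟨ha.trans hb, fun h => ?_, ?_⟩
  · have ha' : dfun t a b = dfun t 0 b := le_antisymm ha (hb.trans h.ge)
    have hb' : dfun t b 0 = dfun t 0 0 := by rw [dfun_comm, ← ha', h]
    exact ⟨(dfun_strictAnti ht b).injective ha', (dfun_strictAnti ht 0).injective hb'⟩
  · rintro ⟨rfl, rfl⟩
    rfl
end

section
/- Let 1 ≤ m ≤ n and let s be a natural number with m + s ≤ n. Then I = R^{S_m×S_n} ∩ J_s; that is, a polynomial f ∈ R that is invariant under S_m × S_n and satisfies the divisibility condition (x_i − y_{i+s}) ∣ (∂f/∂x_i + ∂f/∂y_{i+s}) for every i = 1,…,m automatically satisfies (x_i − y_j) ∣ (∂f/∂x_i + ∂f/∂y_j) for all pairs 1 ≤ i ≤ m, 1 ≤ j ≤ n, and conversely every element of I lies in R^{S_m×S_n} ∩ J_s. -/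
open MvPolynomial

/-- Divisibility of `∂f/∂a + ∂f/∂b` by `X a - X b` is transported along a permutation of the
variables that fixes `f`. -/
theorem X_sub_X_dvd_pderiv_add_of_rename_eq {ι R : Type*} [CommRing R] (e : Equiv.Perm ι)
    {f : MvPolynomial ι R} (hf : rename e f = f) {a b : ι}
    (h : (X a - X b : MvPolynomial ι R) ∣ pderiv a f + pderiv b f) :
    (X (e a) - X (e b) : MvPolynomial ι R) ∣ pderiv (e a) f + pderiv (e b) f := by
  have h' := map_dvd (rename (R := R) e) h
  rw [map_sub, map_add, rename_X, rename_X, ← pderiv_rename e.injective,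
    ← pderiv_rename e.injective, hf] at h'
  exact h'

theorem stmt7 (m n s : ℕ) (hm : 1 ≤ m) (hmn : m ≤ n) (hs : m + s ≤ n) :
    {f : MvPolynomial (Fin m ⊕ Fin n) ℂ |
        (∀ (σ : Equiv.Perm (Fin m)) (τ : Equiv.Perm (Fin n)),
          rename (Equiv.sumCongr σ τ) f = f) ∧
        ∀ (i : Fin m) (j : Fin n),
          (X (Sum.inl i) - X (Sum.inr j) : MvPolynomial (Fin m ⊕ Fin n) ℂ) ∣
            (pderiv (Sum.inl i) f + pderiv (Sum.inr j) f)} =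
      {f : MvPolynomial (Fin m ⊕ Fin n) ℂ |
        ∀ (σ : Equiv.Perm (Fin m)) (τ : Equiv.Perm (Fin n)),
          rename (Equiv.sumCongr σ τ) f = f} ∩
      {f : MvPolynomial (Fin m ⊕ Fin n) ℂ |
        ∀ i : Fin m,
          (X (Sum.inl i) - X (Sum.inr ⟨(i : ℕ) + s, by have := i.2; omega⟩) :
              MvPolynomial (Fin m ⊕ Fin n) ℂ) ∣
            (pderiv (Sum.inl i) f +
              pderiv (Sum.inr ⟨(i : ℕ) + s, by have := i.2; omega⟩) f)} := by
  ext f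
  refine ⟨fun ⟨hf, h⟩ => ⟨hf, fun i => h i _⟩, fun ⟨hf, h⟩ => ⟨hf, fun i j => ?_⟩⟩
  simpa using X_sub_X_dvd_pderiv_add_of_rename_eq
    (Equiv.sumCongr (Equiv.swap ⟨0, hm⟩ i) (Equiv.swap ⟨0 + s, by omega⟩ j)) (hf _ _) (h ⟨0, hm⟩)
end

section
/- In the algebra S, the elements z_i satisfy the following commutation relations for all 1 ≤ i, j ≤ N: x_j z_i = q z_i x_j if j > i and x_j z_i = q^{−1} z_i x_j if j ≤ i; y_j z_i = q^{−1} z_i y_j if j > i and y_j z_i = q z_i y_j if j ≤ i; and z_i z_j = z_j z_i. -/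
open scoped BigOperators

noncomputable section

/-- The base field `F = ℚ(q)`, the field of rational functions in one variable over `ℚ`. -/
abbrev Fq : Type := RatFunc ℚ

/-- The element `q ∈ ℚ(q)`. -/
noncomputable def q : Fq := RatFunc.X

/-- Generators of the free algebra: `Sum.inl i` is `x_i` and `Sum.inr i` is `y_i`
(indices `0,…,N−1` corresponding to the indices `1,…,N` of the paper). -/
abbrev Gen (N : ℕ) := Fin N ⊕ Fin N

/-- `x_i` in the free algebra. -/
noncomputable def FX (N : ℕ) (i : Fin N) : FreeAlgebra Fq (Gen N) :=
  FreeAlgebra.ι Fq (Sum.inl i)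

/-- `y_i` in the free algebra. -/
noncomputable def FY (N : ℕ) (i : Fin N) : FreeAlgebra Fq (Gen N) :=
  FreeAlgebra.ι Fq (Sum.inr i)

/-- Scalars in the free algebra. -/
noncomputable def FC (N : ℕ) (a : Fq) : FreeAlgebra Fq (Gen N) :=
  algebraMap Fq _ a

/-- The defining relations of the algebra `S`:
`x_i x_j = q x_j x_i` for `i > j`; `y_i y_j = q y_j y_i` for `i < j`;
`y_i x_j = x_j y_i` for `i ≠ j`; and
`y_i x_i = q x_i y_i + (q − q⁻¹) Σ_{r=1}^{i−1} (−q)^r x_{i−r} y_{i−r}`. -/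
inductive SRel (N : ℕ) : FreeAlgebra Fq (Gen N) → FreeAlgebra Fq (Gen N) → Prop
  | xx (i j : Fin N) (h : j < i) :
      SRel N (FX N i * FX N j) (FC N q * (FX N j * FX N i))
  | yy (i j : Fin N) (h : i < j) :
      SRel N (FY N i * FY N j) (FC N q * (FY N j * FY N i))
  | yx (i j : Fin N) (h : i ≠ j) :
      SRel N (FY N i * FX N j) (FX N j * FY N i)
  | yxi (i : Fin N) :
      SRel N (FY N i * FX N i)
        (FC N q * (FX N i * FY N i) +
          FC N (q - q⁻¹) *
            ∑ r ∈ Finset.Icc 1 (i : ℕ),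
              FC N ((-q) ^ r) *
                (FX N ⟨(i : ℕ) - r, Nat.lt_of_le_of_lt (Nat.sub_le _ _) i.isLt⟩ *
                 FY N ⟨(i : ℕ) - r, Nat.lt_of_le_of_lt (Nat.sub_le _ _) i.isLt⟩))

/-- The algebra `S`: quotient of the free algebra by the defining relations. -/
abbrev SAlg (N : ℕ) := RingQuot (SRel N)

/-- `x_i ∈ S`. -/
noncomputable def xel (N : ℕ) (i : Fin N) : SAlg N :=
  RingQuot.mkAlgHom Fq (SRel N) (FX N i)

/-- `y_i ∈ S`. -/
noncomputable def yel (N : ℕ) (i : Fin N) : SAlg N :=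
  RingQuot.mkAlgHom Fq (SRel N) (FY N i)

/-- Scalars in `S`. -/
noncomputable def Cq (N : ℕ) (a : Fq) : SAlg N :=
  algebraMap Fq _ a

/-- `z_k = Σ_{r=0}^{k−1} (−q)^r x_{k−r} y_{k−r} ∈ S` (paper indexing `k = 0,1,…,N`,
with `z_0 = 0`); in the `0`-indexed generators this is
`Σ_{j < k} (−q)^{k−1−j} x_j y_j`. -/
noncomputable def zel (N : ℕ) (k : ℕ) : SAlg N :=
  ∑ j : Fin N,
    if (j : ℕ) < k then Cq N ((-q) ^ (k - 1 - (j : ℕ))) * (xel N j * yel N j) else 0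

/-- The balanced quantum integer `[k] = (q^k − q^{−k})/(q − q^{−1})`. -/
noncomputable def qint (k : ℕ) : Fq := (q ^ (k : ℤ) - q ^ (-(k : ℤ))) / (q - q⁻¹)

/-- The balanced quantum factorial `[k]!`. -/
noncomputable def qfact : ℕ → Fq
  | 0 => 1
  | k + 1 => qint (k + 1) * qfact k

/-- The balanced quantum binomial coefficient `[r choose s]`. -/
noncomputable def qbinom (r s : ℕ) : Fq := qfact r / (qfact s * qfact (r - s))

end

section QuantumWeyl

variable {K A : Type*} [Field K] [Ring A] [Algebra K A] {N : ℕ} {c : K} {x y : Fin N → A}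
  {z : ℕ → A}

lemma x_mul_z_of_le (hz0 : z 0 = 0)
    (hz : ∀ i : Fin N, z (i + 1) = x i * y i - c • z i)
    (hxx : ∀ i j : Fin N, j < i → x i * x j = c • (x j * x i))
    (hyx : ∀ i j : Fin N, i ≠ j → y i * x j = x j * y i)
    (j : Fin N) (k : ℕ) (hk : k ≤ j) : x j * z k = c • (z k * x j) := by
  induction k with
  | zero => simp [hz0]
  | succ k ih =>
    let l : Fin N := ⟨k, by omega⟩
    have hlj : l < j := Fin.lt_def.mpr hk
    have h : x j * (x l * y l) = c • (x l * y l * x j) := by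
      rw [← mul_assoc, hxx j l hlj, smul_mul_assoc, mul_assoc, mul_assoc, hyx l j hlj.ne]
    have hzl : z (k + 1) = x l * y l - c • z k := hz l
    rw [hzl, mul_sub, sub_mul, mul_smul_comm, smul_mul_assoc, ih (by omega), h]
    module

lemma y_mul_z_of_le (hc : c ≠ 0) (hz0 : z 0 = 0)
    (hz : ∀ i : Fin N, z (i + 1) = x i * y i - c • z i)
    (hyy : ∀ i j : Fin N, i < j → y i * y j = c • (y j * y i))
    (hyx : ∀ i j : Fin N, i ≠ j → y i * x j = x j * y i)
    (j : Fin N) (k : ℕ) (hk : k ≤ j) : y j * z k = c⁻¹ • (z k * y j) := by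
  induction k with
  | zero => simp [hz0]
  | succ k ih =>
    let l : Fin N := ⟨k, by omega⟩
    have hlj : l < j := Fin.lt_def.mpr hk
    have h : y j * (x l * y l) = c⁻¹ • (x l * y l * y j) := by
      rw [← mul_assoc, hyx j l hlj.ne', mul_assoc, mul_assoc, hyy l j hlj, mul_smul_comm,
        inv_smul_smul₀ hc]
    have hzl : z (k + 1) = x l * y l - c • z k := hz l
    rw [hzl, mul_sub, sub_mul, mul_smul_comm, smul_mul_assoc, ih (by omega), h]
    module

lemma x_mul_z_of_lt (hc : c ≠ 0) (hz0 : z 0 = 0)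
    (hz : ∀ i : Fin N, z (i + 1) = x i * y i - c • z i)
    (hxx : ∀ i j : Fin N, j < i → x i * x j = c • (x j * x i))
    (hyx : ∀ i j : Fin N, i ≠ j → y i * x j = x j * y i)
    (hyxi : ∀ i : Fin N, y i * x i = c • (x i * y i) - (c ^ 2 - 1) • z i)
    (j : Fin N) (k : ℕ) (hjk : (j : ℕ) + 1 ≤ k) (hk : k ≤ N) :
    x j * z k = c⁻¹ • (z k * x j) := by
  induction k, hjk using Nat.le_induction with
  | base =>
    have h := x_mul_z_of_le hz0 hz hxx hyx j j le_rfl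
    have h' : x j * y j * x j = c • (x j * (x j * y j)) - (c ^ 2 - 1) • (c • (z j * x j)) := by
      rw [mul_assoc, hyxi, mul_sub, mul_smul_comm, mul_smul_comm, h]
    rw [hz, mul_sub, sub_mul, mul_smul_comm, smul_mul_assoc, h, h']
    match_scalars <;> field_simp
    ring
  | succ k hjk ih =>
    let l : Fin N := ⟨k, by omega⟩
    have hjl : j < l := Fin.lt_def.mpr hjk
    have h : x j * (x l * y l) = c⁻¹ • (x l * y l * x j) := by
      rw [mul_assoc, hyx l j hjl.ne', ← mul_assoc, ← mul_assoc, hxx l j hjl, smul_mul_assoc,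
        inv_smul_smul₀ hc]
    have hzl : z (k + 1) = x l * y l - c • z k := hz l
    rw [hzl, mul_sub, sub_mul, mul_smul_comm, smul_mul_assoc, ih (by omega), h]
    module

lemma y_mul_z_of_lt (hc : c ≠ 0) (hz0 : z 0 = 0)
    (hz : ∀ i : Fin N, z (i + 1) = x i * y i - c • z i)
    (hyy : ∀ i j : Fin N, i < j → y i * y j = c • (y j * y i))
    (hyx : ∀ i j : Fin N, i ≠ j → y i * x j = x j * y i)
    (hyxi : ∀ i : Fin N, y i * x i = c • (x i * y i) - (c ^ 2 - 1) • z i)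
    (j : Fin N) (k : ℕ) (hjk : (j : ℕ) + 1 ≤ k) (hk : k ≤ N) :
    y j * z k = c • (z k * y j) := by
  induction k, hjk using Nat.le_induction with
  | base =>
    have h := y_mul_z_of_le hc hz0 hz hyy hyx j j le_rfl
    have h' : y j * (x j * y j) = c • (x j * y j * y j) - (c ^ 2 - 1) • (z j * y j) := by
      rw [← mul_assoc, hyxi, sub_mul, smul_mul_assoc, smul_mul_assoc]
    rw [hz, mul_sub, sub_mul, mul_smul_comm, smul_mul_assoc, h, h']
    match_scalars <;> field_simp
    ring
  | succ k hjk ih =>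
    let l : Fin N := ⟨k, by omega⟩
    have hjl : j < l := Fin.lt_def.mpr hjk
    have h : y j * (x l * y l) = c • (x l * y l * y j) := by
      rw [← mul_assoc, hyx j l hjl.ne, mul_assoc, hyy j l hjl, mul_smul_comm, mul_assoc]
    have hzl : z (k + 1) = x l * y l - c • z k := hz l
    rw [hzl, mul_sub, sub_mul, mul_smul_comm, smul_mul_assoc, ih (by omega), h]
    module

lemma commute_z_x_mul_y (hc : c ≠ 0) (hz0 : z 0 = 0)
    (hz : ∀ i : Fin N, z (i + 1) = x i * y i - c • z i)
    (hxx : ∀ i j : Fin N, j < i → x i * x j = c • (x j * x i))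
    (hyy : ∀ i j : Fin N, i < j → y i * y j = c • (y j * y i))
    (hyx : ∀ i j : Fin N, i ≠ j → y i * x j = x j * y i)
    (hyxi : ∀ i : Fin N, y i * x i = c • (x i * y i) - (c ^ 2 - 1) • z i)
    (j : Fin N) (k : ℕ) (hk : k ≤ N) : Commute (z k) (x j * y j) := by
  refine Commute.symm ?_
  rw [Commute, SemiconjBy]
  rcases Nat.lt_or_ge j k with h | h
  · rw [mul_assoc, y_mul_z_of_lt hc hz0 hz hyy hyx hyxi j k h hk, mul_smul_comm, ← mul_assoc,
      x_mul_z_of_lt hc hz0 hz hxx hyx hyxi j k h hk, smul_mul_assoc, smul_inv_smul₀ hc, mul_assoc]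
  · rw [mul_assoc, y_mul_z_of_le hc hz0 hz hyy hyx j k h, mul_smul_comm, ← mul_assoc,
      x_mul_z_of_le hz0 hz hxx hyx j k h, smul_mul_assoc, inv_smul_smul₀ hc, mul_assoc]

end QuantumWeyl

lemma q_ne_zero : q ≠ 0 := RatFunc.X_ne_zero

lemma Cq_mul (N : ℕ) (a : Fq) (s : SAlg N) : Cq N a * s = a • s :=
  (Algebra.smul_def a s).symm

lemma mkAlgHom_FC_mul (N : ℕ) (a : Fq) (s : FreeAlgebra Fq (Gen N)) :
    RingQuot.mkAlgHom Fq (SRel N) (FC N a * s) = a • RingQuot.mkAlgHom Fq (SRel N) s := by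
  rw [FC, ← Algebra.smul_def, map_smul]

lemma xel_mul_xel (N : ℕ) (i j : Fin N) (h : j < i) :
    xel N i * xel N j = q • (xel N j * xel N i) := by
  have hr := RingQuot.mkAlgHom_rel Fq (SRel.xx i j h)
  rw [mkAlgHom_FC_mul, map_mul, map_mul] at hr
  exact hr

lemma yel_mul_yel (N : ℕ) (i j : Fin N) (h : i < j) :
    yel N i * yel N j = q • (yel N j * yel N i) := by
  have hr := RingQuot.mkAlgHom_rel Fq (SRel.yy i j h)
  rw [mkAlgHom_FC_mul, map_mul, map_mul] at hr
  exact hr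

lemma yel_mul_xel (N : ℕ) (i j : Fin N) (h : i ≠ j) :
    yel N i * xel N j = xel N j * yel N i := by
  have hr := RingQuot.mkAlgHom_rel Fq (SRel.yx i j h)
  rw [map_mul, map_mul] at hr
  exact hr

lemma zel_zero (N : ℕ) : zel N 0 = 0 := by simp [zel]

lemma zel_succ (N : ℕ) (i : Fin N) :
    zel N (i + 1) = xel N i * yel N i - q • zel N i := by
  have h : ∀ j : Fin N,
      (if (j : ℕ) < i + 1 then Cq N ((-q) ^ (i + 1 - 1 - (j : ℕ))) * (xel N j * yel N j) else 0) =
      (if j = i then xel N j * yel N j else 0) - q •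
        (if (j : ℕ) < i then Cq N ((-q) ^ (i - 1 - (j : ℕ))) * (xel N j * yel N j) else 0) := by
    intro j
    rcases lt_trichotomy j i with hj | rfl | hj
    · have hj' : (j : ℕ) < i := hj
      have he : (i : ℕ) + 1 - 1 - j = (i - 1 - j) + 1 := by omega
      rw [if_pos (by omega), if_neg hj.ne, if_pos hj', he, pow_succ, Cq_mul, Cq_mul,
        zero_sub, smul_smul, ← neg_smul]
      congr 1
      ring
    · simp [Cq_mul]
    · have hj' : (i : ℕ) < j := hj
      rw [if_neg (by omega), if_neg hj.ne', if_neg (by omega), smul_zero, sub_zero]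
  rw [zel, Finset.sum_congr rfl fun j _ => h j, Finset.sum_sub_distrib, ← Finset.smul_sum,
    Finset.sum_ite_eq' Finset.univ i, if_pos (Finset.mem_univ i), zel]

lemma sum_Icc_xel_mul_yel (N : ℕ) (i : Fin N) :
    ∑ r ∈ Finset.Icc 1 (i : ℕ), (-q) ^ r •
      (xel N ⟨(i : ℕ) - r, Nat.lt_of_le_of_lt (Nat.sub_le _ _) i.isLt⟩ *
        yel N ⟨(i : ℕ) - r, Nat.lt_of_le_of_lt (Nat.sub_le _ _) i.isLt⟩) = -q • zel N i := by
  rw [zel, ← Finset.sum_filter, Finset.smul_sum]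
  refine Finset.sum_bij' (fun r _ => ⟨(i : ℕ) - r, Nat.lt_of_le_of_lt (Nat.sub_le _ _) i.isLt⟩)
    (fun j _ => (i : ℕ) - j) ?_ ?_ ?_ ?_ ?_
  · intro r hr
    simp only [Finset.mem_Icc, Finset.mem_filter, Finset.mem_univ, true_and] at hr ⊢
    omega
  · intro j hj
    simp only [Finset.mem_Icc, Finset.mem_filter, Finset.mem_univ, true_and] at hj ⊢
    omega
  · intro r hr
    simp only [Finset.mem_Icc] at hr ⊢
    omega
  · intro j hj
    simp only [Finset.mem_filter, Finset.mem_univ, true_and] at hj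
    ext
    simp only
    omega
  · intro r hr
    rw [Finset.mem_Icc] at hr
    have he : r = (i - 1 - (i - r)) + 1 := by omega
    rw [Cq_mul, smul_smul, ← pow_succ', ← he]

lemma yel_mul_xel_self (N : ℕ) (i : Fin N) :
    yel N i * xel N i = q • (xel N i * yel N i) - (q ^ 2 - 1) • zel N i := by
  have h := RingQuot.mkAlgHom_rel Fq (SRel.yxi i)
  simp only [map_add, map_sum, map_mul (RingQuot.mkAlgHom Fq (SRel N)) (FX N _),
    map_mul (RingQuot.mkAlgHom Fq (SRel N)) (FY N _), mkAlgHom_FC_mul] at h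
  change yel N i * xel N i = q • (xel N i * yel N i) + (q - q⁻¹) •
    ∑ r ∈ Finset.Icc 1 (i : ℕ), (-q) ^ r •
      (xel N ⟨(i : ℕ) - r, Nat.lt_of_le_of_lt (Nat.sub_le _ _) i.isLt⟩ *
        yel N ⟨(i : ℕ) - r, Nat.lt_of_le_of_lt (Nat.sub_le _ _) i.isLt⟩) at h
  have hs : (q - q⁻¹) * -q = -(q ^ 2 - 1) := by
    have := q_ne_zero
    field_simp
  rw [h, sum_Icc_xel_mul_yel, smul_smul, hs, neg_smul, ← sub_eq_add_neg]

lemma commute_zel (N : ℕ) (k l : ℕ) (hk : k ≤ N) : Commute (zel N k) (zel N l) := by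
  refine Commute.sum_right _ _ _ fun j _ => ?_
  split_ifs
  · rw [Cq_mul]
    exact (commute_z_x_mul_y q_ne_zero (zel_zero N) (zel_succ N) (xel_mul_xel N) (yel_mul_yel N)
      (yel_mul_xel N) (yel_mul_xel_self N) j k hk).smul_right _
  · exact Commute.zero_right _

theorem stmt10 (N : ℕ) (hN : 2 ≤ N) (i j : Fin N) :
    (i < j →
      xel N j * zel N ((i : ℕ) + 1) = Cq N q * (zel N ((i : ℕ) + 1) * xel N j)) ∧
    (j ≤ i →
      xel N j * zel N ((i : ℕ) + 1) = Cq N q⁻¹ * (zel N ((i : ℕ) + 1) * xel N j)) ∧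
    (i < j →
      yel N j * zel N ((i : ℕ) + 1) = Cq N q⁻¹ * (zel N ((i : ℕ) + 1) * yel N j)) ∧
    (j ≤ i →
      yel N j * zel N ((i : ℕ) + 1) = Cq N q * (zel N ((i : ℕ) + 1) * yel N j)) ∧
    zel N ((i : ℕ) + 1) * zel N ((j : ℕ) + 1) =
      zel N ((j : ℕ) + 1) * zel N ((i : ℕ) + 1) := by
  simp only [Cq_mul]
  refine ⟨fun h => ?_, fun h => ?_, fun h => ?_, fun h => ?_, ?_⟩
  · exact x_mul_z_of_le (zel_zero N) (zel_succ N) (xel_mul_xel N) (yel_mul_xel N) j _ h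
  · exact x_mul_z_of_lt q_ne_zero (zel_zero N) (zel_succ N) (xel_mul_xel N) (yel_mul_xel N)
      (yel_mul_xel_self N) j _ (Nat.succ_le_succ h) i.isLt
  · exact y_mul_z_of_le q_ne_zero (zel_zero N) (zel_succ N) (yel_mul_yel N) (yel_mul_xel N) j _ h
  · exact y_mul_z_of_lt q_ne_zero (zel_zero N) (zel_succ N) (yel_mul_yel N) (yel_mul_xel N)
      (yel_mul_xel_self N) j _ (Nat.succ_le_succ h) i.isLt
  · exact commute_zel N _ _ i.isLt
end
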